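/- Let Σ, Σ̃ ∈ ℝ^{n×n} be symmetric positive definite, let β > 0 satisfy Σ̃ ⪯ β Σ (β Σ − Σ̃ positive semidefinite), let α ≥ 0, and let 𝒜* , ε ≥ 0 be such that (1/Γ(n/2)) ∫₀^{α/(2β)} t^{n/2 − 1} e^{−t} dt > 1 − 𝒜* − ε. If r̃ ∼ N(0, Σ̃) is a multivariate Gaussian random vector on ℝⁿ, then P[r̃ᵀ Σ^{−1} r̃ ≤ α] > 1 − 𝒜* − ε; equivalently, the false alarm probability satisfies P[r̃ᵀ Σ^{−1} r̃ > α] < 𝒜* + ε. -/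

import Mathlib

open Matrix MeasureTheory ProbabilityTheory

/-- A random vector `X` on `(Ω, P)` is Gaussian with mean `m` and covariance matrix `S`
iff every linear functional `t ⬝ᵥ X` has the one-dimensional Gaussian law with mean
`t ⬝ᵥ m` and variance `tᵀ S t` (Cramér–Wold characterization). -/
def IsGaussianVector {Ω : Type*} [MeasurableSpace Ω] (P : Measure Ω)
    {d : Type*} [Fintype d] (X : Ω → d → ℝ) (m : d → ℝ) (S : Matrix d d ℝ) : Prop :=
  ∀ t : d → ℝ, Measure.map (fun ω => t ⬝ᵥ X ω) P
      = ProbabilityTheory.gaussianReal (t ⬝ᵥ m) (t ⬝ᵥ S.mulVec t).toNNReal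

open scoped MatrixOrder in
/-- A positive definite matrix is the inverse of some `Bᵀ * B` with `B` invertible. -/
lemma Matrix.PosDef.exists_inv_eq_transpose_mul_self {d : Type*} [Fintype d] [DecidableEq d]
    {S : Matrix d d ℝ} (hS : S.PosDef) :
    ∃ B : Matrix d d ℝ, S⁻¹ = Bᵀ * B ∧ B * S * Bᵀ = 1 := by
  obtain ⟨B, hB⟩ := CStarAlgebra.nonneg_iff_eq_star_mul_self.mp hS.inv.posSemidef.nonneg
  rw [star_eq_conjTranspose, conjTranspose_eq_transpose_of_trivial] at hB
  refine ⟨B, hB, ?_⟩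
  have hdet : IsUnit S.det := (isUnit_iff_isUnit_det S).1 hS.isUnit
  have h : Bᵀ * (B * S) = 1 := by rw [← mul_assoc, ← hB, nonsing_inv_mul _ hdet]
  exact mul_eq_one_comm.1 h

/-- Variational lower bound for the quadratic form of an inverse matrix. -/
lemma Matrix.PosDef.two_mul_dotProduct_sub_le_dotProduct_inv_mulVec
    {d : Type*} [Fintype d] [DecidableEq d] {T : Matrix d d ℝ} (hT : T.PosDef) (x y : d → ℝ) :
    2 * (x ⬝ᵥ y) - y ⬝ᵥ T *ᵥ y ≤ x ⬝ᵥ T⁻¹ *ᵥ x := by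
  have hdet : IsUnit T.det := (isUnit_iff_isUnit_det T).1 hT.isUnit
  have hnonneg := hT.inv.posSemidef.dotProduct_mulVec_nonneg (x - T *ᵥ y)
  have hsymm : (T *ᵥ y) ⬝ᵥ T⁻¹ *ᵥ x = x ⬝ᵥ y := by
    have hTt : T⁻¹ᵀ = T⁻¹ := hT.inv.isHermitian
    rw [dotProduct_mulVec, ← mulVec_transpose, hTt, mulVec_mulVec, nonsing_inv_mul _ hdet,
      one_mulVec, dotProduct_comm]
  simp only [star_trivial, mulVec_sub, mulVec_mulVec, nonsing_inv_mul _ hdet, one_mulVec,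
    sub_dotProduct, dotProduct_sub, hsymm] at hnonneg
  rw [dotProduct_comm (T *ᵥ y) y] at hnonneg
  linarith

/-- Inversion reverses the Loewner order, at the level of quadratic forms. -/
lemma Matrix.PosDef.dotProduct_inv_mulVec_le {d : Type*} [Fintype d] [DecidableEq d]
    {S T : Matrix d d ℝ} (hS : S.PosDef) (hT : T.PosDef) {β : ℝ} (hβ : 0 < β)
    (hle : (β • S - T).PosSemidef) (x : d → ℝ) :
    x ⬝ᵥ S⁻¹ *ᵥ x ≤ β * (x ⬝ᵥ T⁻¹ *ᵥ x) := by
  have hdet : IsUnit S.det := (isUnit_iff_isUnit_det S).1 hS.isUnit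
  have hvar := hT.two_mul_dotProduct_sub_le_dotProduct_inv_mulVec x (β⁻¹ • S⁻¹ *ᵥ x)
  have hloewner := hle.dotProduct_mulVec_nonneg (β⁻¹ • S⁻¹ *ᵥ x)
  have hSS : (β⁻¹ • S⁻¹ *ᵥ x) ⬝ᵥ S *ᵥ (β⁻¹ • S⁻¹ *ᵥ x) = β⁻¹ * (β⁻¹ * (x ⬝ᵥ S⁻¹ *ᵥ x)) := by
    rw [mulVec_smul, mulVec_mulVec, mul_nonsing_inv _ hdet, one_mulVec, smul_dotProduct,
      dotProduct_smul, smul_eq_mul, smul_eq_mul, dotProduct_comm]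
  rw [star_trivial, sub_mulVec, dotProduct_sub, smul_mulVec, dotProduct_smul, hSS, smul_eq_mul,
    mul_inv_cancel_left₀ hβ.ne'] at hloewner
  rw [dotProduct_smul, smul_eq_mul] at hvar
  have hbound : β⁻¹ * (x ⬝ᵥ S⁻¹ *ᵥ x) ≤ x ⬝ᵥ T⁻¹ *ᵥ x := by linarith
  rwa [inv_mul_le_iff₀ hβ] at hbound

section StdGaussian

variable {E : Type*} [NormedAddCommGroup E] [InnerProductSpace ℝ E] [FiniteDimensional ℝ E]
  [MeasurableSpace E] [BorelSpace E]

variable (E) in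
lemma integrable_exp_neg_norm_sq_div_two : Integrable fun x : E ↦ Real.exp (-‖x‖ ^ 2 / 2) := by
  refine (GaussianFourier.integrable_cexp_neg_mul_sq_norm_add (V := E) (b := 1 / 2)
    (by norm_num) 0 0).re.congr (.of_forall fun x ↦ ?_)
  have h : (-(1 / 2 : ℂ) * (‖x‖ : ℂ) ^ 2 + 0 * (inner ℝ 0 x : ℝ)) = ((-‖x‖ ^ 2 / 2 : ℝ) : ℂ) := by
    push_cast
    ring
  simp only [h]
  exact Complex.exp_ofReal_re _

variable (E) in
/-- The standard Gaussian measure has density `(2π)^(-n/2) exp (-‖x‖² / 2)`. -/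
lemma stdGaussian_eq_withDensity :
    stdGaussian E = volume.withDensity fun x : E ↦ ENNReal.ofReal
      (((2 * Real.pi) ^ (Module.finrank ℝ E / 2 : ℝ))⁻¹ * Real.exp (-‖x‖ ^ 2 / 2)) := by
  set K : ℝ := (2 * Real.pi) ^ (Module.finrank ℝ E / 2 : ℝ) with hK
  have hKpos : 0 < K := by positivity
  have hfin := isFiniteMeasure_withDensity_ofReal
    ((integrable_exp_neg_norm_sq_div_two E).const_mul K⁻¹).2
  refine Measure.ext_of_charFun (funext fun t ↦ ?_)
  rw [charFun_stdGaussian, charFun_apply, integral_withDensity_eq_integral_toReal_smul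
    (by fun_prop) (.of_forall fun _ ↦ ENNReal.ofReal_lt_top)]
  have hintegrand (x : E) : (ENNReal.ofReal (K⁻¹ * Real.exp (-‖x‖ ^ 2 / 2))).toReal •
      Complex.exp ((inner ℝ x t : ℝ) * Complex.I) = (K⁻¹ : ℂ) *
        Complex.exp (-(1 / 2 : ℂ) * (‖x‖ : ℂ) ^ 2 + Complex.I * (inner ℝ t x : ℝ)) := by
    rw [ENNReal.toReal_ofReal (by positivity), Complex.real_smul, Complex.exp_add,
      real_inner_comm]
    push_cast
    ring_nf
  have hconst : ((Real.pi : ℂ) / (1 / 2)) ^ (Module.finrank ℝ E / 2 : ℂ) = K := by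
    rw [hK, Complex.ofReal_cpow (by positivity)]
    push_cast
    ring_nf
  simp_rw [hintegrand]
  rw [integral_const_mul, GaussianFourier.integral_cexp_neg_mul_sq_norm_add (by norm_num), hconst,
    inv_mul_cancel_left₀ (by exact_mod_cast hKpos.ne'), Complex.I_sq]
  ring_nf

/-- Change of variables `t = y² / 2` in a truncated Gamma integral. -/
lemma integral_Ioi_indicator_pow_mul_exp_neg_sq_div_two {n : ℕ} (hn : n ≠ 0) (c : ℝ) :
    ∫ y in Set.Ioi (0 : ℝ), y ^ (n - 1) *
        {y : ℝ | y ^ 2 ≤ c}.indicator (fun y ↦ Real.exp (-y ^ 2 / 2)) y =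
      2 ^ ((n : ℝ) / 2 - 1) *
        ∫ t in Set.Ioc (0 : ℝ) (c / 2), t ^ ((n : ℝ) / 2 - 1) * Real.exp (-t) := by
  set h : ℝ → ℝ := (Set.Iic (c / 2)).indicator
    fun t ↦ t ^ ((n : ℝ) / 2 - 1) * Real.exp (-t) with hh
  have hIoc : ∫ t in Set.Ioc (0 : ℝ) (c / 2), t ^ ((n : ℝ) / 2 - 1) * Real.exp (-t) =
      ∫ t in Set.Ioi (0 : ℝ), h t := by
    rw [hh, setIntegral_indicator measurableSet_Iic, Set.Ioi_inter_Iic]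
  have hscale := integral_comp_mul_left_Ioi' h 0 (b := 1 / 2) (by norm_num)
  rw [mul_zero, ← integral_comp_rpow_Ioi_of_pos (p := 2) (by norm_num)] at hscale
  rw [hIoc, ← hscale, smul_eq_mul, ← integral_const_mul, ← integral_const_mul]
  refine setIntegral_congr_fun measurableSet_Ioi fun y (hy : 0 < y) ↦ ?_
  have hmem : (1 / 2 * y ^ 2 ≤ c / 2) ↔ y ^ 2 ≤ c := by constructor <;> intro <;> linarith
  simp only [hh, Set.indicator_apply, Set.mem_ofPred_eq, Set.mem_Iic, Real.rpow_two, hmem,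
    smul_eq_mul]
  split_ifs
  · have hpow : (2 : ℝ) ^ ((n : ℝ) / 2 - 1) * (1 / 2 * y ^ 2) ^ ((n : ℝ) / 2 - 1) * y
        = y ^ (n - 1) := by
      rw [← Real.mul_rpow (by norm_num) (by positivity), ← mul_assoc, mul_one_div_cancel two_ne_zero,
        one_mul, ← Real.rpow_natCast_mul hy.le, ← Real.rpow_add_one hy.ne', ← Real.rpow_natCast,
        Nat.cast_sub (Nat.one_le_iff_ne_zero.2 hn)]
      congr 1
      push_cast
      ring
    rw [← hpow, show (2 : ℝ) - 1 = 1 by norm_num, Real.rpow_one,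
      show -(1 / 2 * y ^ 2) = -y ^ 2 / 2 by ring]
    ring
  · simp

variable (E) in
/-- The squared norm of a standard Gaussian vector has the chi-squared distribution function. -/
lemma stdGaussian_real_norm_sq_le [Nontrivial E] (c : ℝ) :
    (stdGaussian E).real {x | ‖x‖ ^ 2 ≤ c} =
      (1 / Real.Gamma ((Module.finrank ℝ E : ℝ) / 2)) *
        ∫ t in Set.Ioc (0 : ℝ) (c / 2),
          t ^ ((Module.finrank ℝ E : ℝ) / 2 - 1) * Real.exp (-t) := by
  have hn : 0 < Module.finrank ℝ E := Module.finrank_pos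
  have hmeas : MeasurableSet {x : E | ‖x‖ ^ 2 ≤ c} := measurableSet_le (by fun_prop) (by fun_prop)
  have hdensity := (integrable_exp_neg_norm_sq_div_two E).const_mul
    ((2 * Real.pi) ^ (Module.finrank ℝ E / 2 : ℝ))⁻¹
  rw [stdGaussian_eq_withDensity, measureReal_def, withDensity_apply _ hmeas,
    ← ofReal_integral_eq_lintegral_ofReal hdensity.integrableOn (.of_forall fun _ ↦ by positivity),
    ENNReal.toReal_ofReal (integral_nonneg fun _ ↦ by positivity), integral_const_mul,
    ← integral_indicator hmeas]
  have hradial := integral_fun_norm_addHaar (volume : Measure E)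
    ({y : ℝ | y ^ 2 ≤ c}.indicator fun y ↦ Real.exp (-y ^ 2 / 2))
  simp only [smul_eq_mul, nsmul_eq_mul] at hradial
  rw [integral_Ioi_indicator_pow_mul_exp_neg_sq_div_two hn.ne', measureReal_def,
    InnerProductSpace.volume_ball] at hradial
  have hcomp : {x : E | ‖x‖ ^ 2 ≤ c}.indicator (fun x ↦ Real.exp (-‖x‖ ^ 2 / 2)) =
      fun x ↦ {y : ℝ | y ^ 2 ≤ c}.indicator (fun y ↦ Real.exp (-y ^ 2 / 2)) ‖x‖ := rfl
  rw [hcomp, hradial]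
  generalize Module.finrank ℝ E = n at hn ⊢
  generalize ∫ t in Set.Ioc (0 : ℝ) (c / 2), t ^ ((n : ℝ) / 2 - 1) * Real.exp (-t) = J
  have hn' : (0 : ℝ) < n := by exact_mod_cast hn
  have hΓ : 0 < Real.Gamma ((n : ℝ) / 2) := Real.Gamma_pos_of_pos (by positivity)
  have hsqrt : √Real.pi ^ n = Real.pi ^ ((n : ℝ) / 2) := by
    rw [Real.sqrt_eq_rpow, ← Real.rpow_mul_natCast Real.pi_pos.le]
    ring_nf
  rw [ENNReal.ofReal_one, one_pow, one_mul, Real.Gamma_add_one (by positivity), hsqrt,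
    ENNReal.toReal_ofReal (by positivity), Real.mul_rpow (by norm_num) Real.pi_pos.le,
    Real.rpow_sub_one two_ne_zero]
  field_simp

end StdGaussian

section IsGaussianVector

variable {Ω : Type*} [MeasurableSpace Ω] {P : Measure Ω} {d : Type*} [Fintype d]
  {X : Ω → d → ℝ} {m : d → ℝ} {S : Matrix d d ℝ}

lemma IsGaussianVector.isProbabilityMeasure (h : IsGaussianVector P X m S) :
    IsProbabilityMeasure P := by
  have hmap : IsProbabilityMeasure (P.map fun ω ↦ (0 : d → ℝ) ⬝ᵥ X ω) := by
    rw [h 0]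
    infer_instance
  exact Measure.isProbabilityMeasure_of_map (fun ω ↦ (0 : d → ℝ) ⬝ᵥ X ω)

lemma IsGaussianVector.mulVec {e : Type*} [Fintype e] (h : IsGaussianVector P X m S)
    (B : Matrix e d ℝ) : IsGaussianVector P (fun ω ↦ B *ᵥ X ω) (B *ᵥ m) (B * S * Bᵀ) := by
  intro t
  have hB (v : d → ℝ) : t ⬝ᵥ B *ᵥ v = (Bᵀ *ᵥ t) ⬝ᵥ v := by
    rw [dotProduct_mulVec, mulVec_transpose]
  simp only [← mulVec_mulVec, hB, h (Bᵀ *ᵥ t)]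

lemma IsGaussianVector.map_toLp_eq_stdGaussian [DecidableEq d] (hX : Measurable X)
    (h : IsGaussianVector P X 0 1) :
    P.map (fun ω ↦ WithLp.toLp 2 (X ω)) = stdGaussian (EuclideanSpace ℝ d) := by
  have hprob := h.isProbabilityMeasure
  have hX' : Measurable fun ω ↦ WithLp.toLp 2 (X ω) := by fun_prop
  have := Measure.isProbabilityMeasure_map (μ := P) hX'.aemeasurable
  refine Measure.ext_of_charFun (funext fun t ↦ ?_)
  have hlaw := h t.ofLp
  have hcf : charFun (P.map fun ω ↦ t.ofLp ⬝ᵥ X ω) 1 =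
      charFun (P.map fun ω ↦ WithLp.toLp 2 (X ω)) t := by
    rw [charFun_apply, charFun_apply, integral_map (by fun_prop) (by fun_prop),
      integral_map (by fun_prop) (by fun_prop)]
    simp [PiLp.inner_apply, dotProduct, mul_comm]
  have hnorm : t.ofLp ⬝ᵥ t.ofLp = ‖t‖ ^ 2 := by
    rw [EuclideanSpace.real_norm_sq_eq]
    simp [dotProduct, sq]
  rw [← hcf, hlaw, charFun_gaussianReal, charFun_stdGaussian, one_mulVec, hnorm, dotProduct_zero,
    Real.coe_toNNReal _ (by positivity)]
  push_cast
  ring_nf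

/-- The squared Mahalanobis distance of a centered Gaussian vector has the chi-squared
distribution function. -/
lemma IsGaussianVector.real_dotProduct_inv_mulVec_le [DecidableEq d] [Nonempty d]
    (hX : Measurable X) (hS : S.PosDef) (h : IsGaussianVector P X 0 S) (c : ℝ) :
    P.real {ω | X ω ⬝ᵥ S⁻¹ *ᵥ X ω ≤ c} =
      (1 / Real.Gamma ((Fintype.card d : ℝ) / 2)) *
        ∫ t in Set.Ioc (0 : ℝ) (c / 2), t ^ ((Fintype.card d : ℝ) / 2 - 1) * Real.exp (-t) := by
  obtain ⟨B, hB, hBS⟩ := hS.exists_inv_eq_transpose_mul_self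
  have hBX : Measurable fun ω ↦ B *ᵥ X ω := by
    have hcont : Continuous fun v : d → ℝ ↦ B *ᵥ v := by fun_prop
    exact hcont.measurable.comp hX
  have hlaw := h.mulVec B
  rw [hBS, mulVec_zero] at hlaw
  have hchi := stdGaussian_real_norm_sq_le (EuclideanSpace ℝ d) c
  rw [finrank_euclideanSpace, ← hlaw.map_toLp_eq_stdGaussian hBX,
    map_measureReal_apply (by fun_prop) (measurableSet_le (by fun_prop) (by fun_prop))] at hchi
  rw [← hchi]
  congr 1
  ext ω
  have hnorm : ‖WithLp.toLp 2 (B *ᵥ X ω)‖ ^ 2 = X ω ⬝ᵥ S⁻¹ *ᵥ X ω := by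
    rw [EuclideanSpace.real_norm_sq_eq, hB, ← mulVec_mulVec, dotProduct_mulVec, vecMul_transpose]
    simp [dotProduct, sq]
  simp [hnorm]

end IsGaussianVector

/-- If `Σ̃ ⪯ β Σ` (Loewner order) with `Σ, Σ̃` symmetric positive
definite and `β > 0`, and the regularized lower incomplete gamma value
`(1/Γ(n/2)) ∫₀^{α/(2β)} t^{n/2−1} e^{−t} dt` exceeds `1 − 𝒜* − ε`, then for
`r̃ ∼ N(0, Σ̃)` the false alarm constraint holds:
`P[r̃ᵀ Σ⁻¹ r̃ ≤ α] > 1 − 𝒜* − ε`, equivalently `P[r̃ᵀ Σ⁻¹ r̃ > α] < 𝒜* + ε`. -/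
theorem stmt10 {Ω : Type*} [MeasurableSpace Ω] (P : Measure Ω) (n : ℕ)
    (S St : Matrix (Fin n) (Fin n) ℝ) (hS : S.PosDef) (hSt : St.PosDef)
    (β : ℝ) (hβ : 0 < β) (hle : (β • S - St).PosSemidef)
    (α : ℝ) (hα : 0 ≤ α) (A ε : ℝ) (hA : 0 ≤ A) (hε : 0 ≤ ε)
    (hgam : 1 - A - ε < (1 / Real.Gamma ((n : ℝ) / 2)) *
      ∫ t in Set.Ioc (0 : ℝ) (α / (2 * β)), t ^ ((n : ℝ) / 2 - 1) * Real.exp (-t))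
    (r : Ω → Fin n → ℝ) (hrm : Measurable r) (hr : IsGaussianVector P r 0 St) :
    1 - A - ε < (P {ω | r ω ⬝ᵥ S⁻¹.mulVec (r ω) ≤ α}).toReal ∧
    (P {ω | α < r ω ⬝ᵥ S⁻¹.mulVec (r ω)}).toReal < A + ε := by
  have hprob := hr.isProbabilityMeasure
  have hcont : Continuous fun v : Fin n → ℝ ↦ v ⬝ᵥ S⁻¹ *ᵥ v := by fun_prop
  have hmeas : MeasurableSet {ω | r ω ⬝ᵥ S⁻¹ *ᵥ r ω ≤ α} :=
    measurableSet_le (hcont.measurable.comp hrm) measurable_const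
  have hlower : 1 - A - ε < P.real {ω | r ω ⬝ᵥ S⁻¹ *ᵥ r ω ≤ α} := by
    obtain rfl | hn := Nat.eq_zero_or_pos n
    · have huniv : {ω | r ω ⬝ᵥ S⁻¹ *ᵥ r ω ≤ α} = Set.univ := by
        ext ω
        simpa [dotProduct] using hα
      have hneg : 1 - A - ε < 0 := by simpa using hgam
      rw [huniv, probReal_univ]
      linarith
    · have : Nonempty (Fin n) := Fin.pos_iff_nonempty.1 hn
      have hchi := hr.real_dotProduct_inv_mulVec_le hrm hSt (α / β)
      rw [Fintype.card_fin, div_div, mul_comm β 2] at hchi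
      rw [← hchi] at hgam
      refine hgam.trans_le (measureReal_mono fun ω hω ↦ ?_)
      rw [Set.mem_ofPred_eq, le_div_iff₀' hβ] at hω
      exact (hS.dotProduct_inv_mulVec_le hSt hβ hle (r ω)).trans hω
  refine ⟨hlower, ?_⟩
  have hcompl : {ω | α < r ω ⬝ᵥ S⁻¹ *ᵥ r ω} = {ω | r ω ⬝ᵥ S⁻¹ *ᵥ r ω ≤ α}ᶜ := by
    ext ω
    simp
  rw [hcompl, ← measureReal_def, probReal_compl_eq_one_sub hmeas]
  linarith
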